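/- Every affine bijection σ of the Gram set 𝒢_N onto itself is induced by a permutation combined with partial reflections: there exist an N×N permutation matrix P and a diagonal matrix D with diagonal entries ±1 such that σ(G) = (D P) G (D P)ᵀ for all G ∈ 𝒢_N. -/

import Mathlib

open Matrix

/-- The Gram set: real symmetric positive semidefinite `N × N` matrices with unit diagonal. -/
def GramSet (N : ℕ) : Set (Matrix (Fin N) (Fin N) ℝ) :=
  {G | G.PosSemidef ∧ ∀ i, G i i = 1}

/-- `σ` is an affine bijection of the Gram set `𝒢_N` onto itself. -/
def IsAffineBijOfGramSet (N : ℕ)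
    (σ : Matrix (Fin N) (Fin N) ℝ → Matrix (Fin N) (Fin N) ℝ) : Prop :=
  Set.BijOn σ (GramSet N) (GramSet N) ∧
    ∀ G ∈ GramSet N, ∀ G' ∈ GramSet N, ∀ α : ℝ, 0 ≤ α → α ≤ 1 →
      σ (α • G + (1 - α) • G') = α • σ G + (1 - α) • σ G'

section

open Finset

theorem exists_perm_of_symmDiff {α : Type*} [Fintype α] [DecidableEq α]
    (P : α → α → Finset α) (hcard : ∀ i j, i ≠ j → (P i j).card = 2)
    (hadd : ∀ i j k m, m ∈ P j k ↔ ¬ (m ∈ P i j ↔ m ∈ P i k))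
    (hinj : ∀ i j k l, i ≠ j → k ≠ l → i ≠ k → i ≠ l → P i j ≠ P k l) :
    ∃ e : Equiv.Perm α, ∀ i j, i ≠ j → P i j = {e i, e j} := by
  classical
  rcases isEmpty_or_nonempty α with h | ⟨⟨o⟩⟩
  · exact ⟨1, fun i => h.elim i⟩
  by_cases hsub : ∀ i, i = o
  · exact ⟨1, fun i j hij => absurd ((hsub i).trans (hsub j).symm) hij⟩
  push Not at hsub
  obtain ⟨i, hi⟩ := hsub
  have hcommon : ∃ a, ∀ j, j ≠ o → a ∈ P o j := by
    obtain ⟨a, b, hab, hPi⟩ := card_eq_two.1 (hcard o i hi.symm)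
    by_contra hcon
    push Not at hcon
    obtain ⟨j, hj, haj⟩ := hcon a
    obtain ⟨k, hk, hbk⟩ := hcon b
    have hij : i ≠ j := by rintro rfl; simp [hPi] at haj
    have hik : i ≠ k := by rintro rfl; simp [hPi] at hbk
    have hsd : ∀ p q, P p q = symmDiff (P o p) (P o q) := by
      intro p q; ext m; rw [hadd o p q m, mem_symmDiff]; tauto
    obtain ⟨c, d, hcd, hPj⟩ := card_eq_two.1 (hcard o j hj.symm)
    obtain ⟨c', d', hcd', hPk⟩ := card_eq_two.1 (hcard o k hk.symm)
    have meet : ∀ p q, p ≠ o → q ≠ o → p ≠ q → (P o p ∩ P o q).card = 1 := by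
      intro p q hp hq hpq
      have h1 := hcard p q hpq
      have h2 := card_sdiff_add_card_inter (P o p) (P o q)
      have h3 := card_sdiff_add_card_inter (P o q) (P o p)
      have h4 : (symmDiff (P o p) (P o q)).card = (P o p \ P o q).card + (P o q \ P o p).card :=
        card_union_of_disjoint (disjoint_sdiff_sdiff)
      rw [← hsd p q, h1] at h4
      rw [hcard _ _ hp.symm] at h2
      rw [hcard _ _ hq.symm, inter_comm] at h3
      omega
    have hbj : b ∈ P o j := by
      have := meet i j hi hj hij
      obtain ⟨x, hx⟩ := card_pos.1 (by omega : 0 < (P o i ∩ P o j).card)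
      grind
    have hak : a ∈ P o k := by
      have := meet i k hi hk hik
      obtain ⟨x, hx⟩ := card_pos.1 (by omega : 0 < (P o i ∩ P o k).card)
      grind
    have hjk : j ≠ k := by rintro rfl; exact haj hak
    obtain ⟨x, hx⟩ := card_pos.1 (by rw [meet j k hj hk hjk]; omega : 0 < (P o j ∩ P o k).card)
    refine hinj o i j k hi.symm hjk hj.symm hk.symm ?_
    rw [mem_inter] at hx
    ext m
    rw [hadd o j k m]
    grind
  obtain ⟨a, ha⟩ := hcommon
  have hother : ∀ j, j ≠ o → ∃ b, b ≠ a ∧ P o j = {a, b} := by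
    intro j hj
    obtain ⟨c, d, hcd, hPj⟩ := card_eq_two.1 (hcard o j hj.symm)
    have := ha j hj
    rw [hPj] at this ⊢
    simp only [mem_insert, mem_singleton] at this
    rcases this with rfl | rfl
    · exact ⟨d, hcd.symm, rfl⟩
    · exact ⟨c, hcd, pair_comm _ _⟩
  choose! f hfa hf using hother
  have hP : ∀ j k, j ≠ k →
      P j k = {if j = o then a else f j, if k = o then a else f k} := by
    intro j k hjk
    have hoo : P o o = ∅ := by
      ext m; rw [hadd o o o m]; simp
    by_cases hj : j = o
    · subst hj
      simp [hf k hjk.symm, hjk.symm]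
    by_cases hk : k = o
    · subst hk
      ext m
      rw [hadd k j k m, hoo, hf j hj]
      have := hfa j hj
      simp only [hj, if_false, if_true, mem_insert, mem_singleton, notMem_empty, iff_false]
      grind
    have hne : f j ≠ f k := by
      intro h
      have h0 : P j k = ∅ := by
        ext m; rw [hadd o j k m, hf j hj, hf k hk, h]; simp
      have := hcard j k hjk
      simp [h0] at this
    ext m
    rw [hadd o j k m, hf j hj, hf k hk]
    have h1 := hfa j hj
    have h2 := hfa k hk
    simp only [hj, hk, if_false, mem_insert, mem_singleton]
    grind
  have hinj' : Function.Injective (fun j => if j = o then a else f j) := by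
    intro j k hjk
    by_contra h
    have h1 := hP j k h
    have h2 := hcard j k h
    simp only at hjk
    rw [h1, hjk] at h2
    simp at h2
  exact ⟨Equiv.ofBijective _ (Finite.injective_iff_bijective.1 hinj'), hP⟩

end

theorem sum_signs_eq_zero {ι : Type*} [Fintype ι] [DecidableEq ι] (l : ι) (f : (ι → ℤˣ) → ℝ)
    (hf : ∀ u, f (Pi.mulSingle l (-1) * u) = -f u) : ∑ u, f u = 0 := by
  have h := Equiv.sum_comp (Equiv.mulLeft (Pi.mulSingle l (-1) : ι → ℤˣ)) f
  simp only [Equiv.coe_mulLeft, hf, Finset.sum_neg_distrib] at h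
  linarith

theorem sum_signs_mul {ι : Type*} [Fintype ι] [DecidableEq ι] (l m : ι) :
    ∑ u : ι → ℤˣ, ((u l : ℤ) : ℝ) * ((u m : ℤ) : ℝ) =
      if l = m then (Fintype.card (ι → ℤˣ) : ℝ) else 0 := by
  split_ifs with h
  · subst h
    have (u : ι → ℤˣ) : ((u l : ℤ) : ℝ) * ((u l : ℤ) : ℝ) = 1 := by
      rcases Int.units_eq_one_or (u l) with h | h <;> simp [h]
    simp [this]
  · apply sum_signs_eq_zero l
    intro u
    simp [Pi.mulSingle_eq_of_ne (Ne.symm h)]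

theorem sum_signs_linear_mul {ι : Type*} [Fintype ι] [DecidableEq ι] (α β : ι → ℝ) :
    ∑ u : ι → ℤˣ, (∑ l, α l * ((u l : ℤ) : ℝ)) * (∑ m, β m * ((u m : ℤ) : ℝ)) =
      (Fintype.card (ι → ℤˣ) : ℝ) * ∑ l, α l * β l := by
  simp_rw [Finset.sum_mul_sum]
  rw [Finset.sum_comm]
  simp_rw [Finset.sum_comm (s := (Finset.univ : Finset (ι → ℤˣ)))]
  have (l m : ι) : ∑ u : ι → ℤˣ, α l * ((u l : ℤ) : ℝ) * (β m * ((u m : ℤ) : ℝ)) =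
      α l * β m * if l = m then (Fintype.card (ι → ℤˣ) : ℝ) else 0 := by
    rw [← sum_signs_mul, Finset.mul_sum]
    exact Finset.sum_congr rfl fun u _ => by ring
  simp_rw [this]
  simp [Finset.mul_sum, mul_comm]

/-- Flipping one sign changes a quadratic form with zero diagonal by a linear form. -/
theorem quadratic_flip {ι : Type*} [Fintype ι] [DecidableEq ι] {a : Matrix ι ι ℝ}
    (hs : a.IsSymm) (hd : ∀ i, a i i = 0) (x : ι → ℝ) (k : ι) :
    Function.update x k (-x k) ⬝ᵥ a *ᵥ Function.update x k (-x k) =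
      x ⬝ᵥ a *ᵥ x - 4 * (x k * (a *ᵥ x) k) := by
  have h : Function.update x k (-x k) = x - Pi.single k (2 * x k) := by
    ext i
    by_cases hi : i = k
    · subst hi; simp; ring
    · simp [hi]
  have h2 : x ⬝ᵥ a *ᵥ Pi.single k (2 * x k) = (a *ᵥ x) k * (2 * x k) := by
    rw [dotProduct_mulVec, ← mulVec_transpose, hs.eq, dotProduct_single]
  rw [h, mulVec_sub, sub_dotProduct, dotProduct_sub, dotProduct_sub, h2]
  simp [hd]
  ring

theorem mulVec_flip {ι : Type*} [Fintype ι] [DecidableEq ι] (a : Matrix ι ι ℝ)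
    (x : ι → ℝ) (i k : ι) :
    (a *ᵥ Function.update x k (-x k)) i = (a *ᵥ x) i - 2 * a i k * x k := by
  have h : Function.update x k (-x k) = x - Pi.single k (2 * x k) := by
    ext i
    by_cases hi : i = k
    · subst hi; simp; ring
    · simp [hi]
  rw [h, mulVec_sub]
  simp
  ring

section BooleanQuadratic

variable {ι : Type*} [Fintype ι] [DecidableEq ι] {a : Matrix ι ι ℝ}

theorem sq_mulVec_of_boolean (hs : a.IsSymm) (hd : ∀ i, a i i = 0)
    (hv : ∀ x : ι → ℝ, (∀ i, x i = 1 ∨ x i = -1) → (x ⬝ᵥ a *ᵥ x) ^ 2 = 4)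
    {x : ι → ℝ} (hx : ∀ i, x i = 1 ∨ x i = -1) (i : ι) :
    2 * (a *ᵥ x) i ^ 2 = x i * (a *ᵥ x) i * (x ⬝ᵥ a *ᵥ x) := by
  have hx' : ∀ j, Function.update x i (-x i) j = 1 ∨ Function.update x i (-x i) j = -1 := by
    intro j
    by_cases hj : j = i
    · subst hj; rcases hx j with h | h <;> simp [h]
    · simpa [hj] using hx j
  have h1 := hv x hx
  have h2 := hv _ hx'
  rw [quadratic_flip hs hd] at h2
  have h3 : x i ^ 2 = 1 := by rcases hx i with h | h <;> simp [h]
  have : 16 * (x i ^ 2 * (a *ᵥ x) i ^ 2) = 8 * (x i * (a *ᵥ x) i * (x ⬝ᵥ a *ᵥ x)) := by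
    linear_combination h2 - h1
  rw [h3] at this
  linarith

theorem sum_sq_of_boolean [Nonempty ι] (hs : a.IsSymm) (hd : ∀ i, a i i = 0)
    (hv : ∀ x : ι → ℝ, (∀ i, x i = 1 ∨ x i = -1) → (x ⬝ᵥ a *ᵥ x) ^ 2 = 4) :
    ∑ i, ∑ l, a i l * a i l = 2 := by
  have hu (u : ι → ℤˣ) : ∑ i, (∑ l, a i l * ((u l : ℤ) : ℝ)) * (∑ l, a i l * ((u l : ℤ) : ℝ))
      = 2 := by
    set x : ι → ℝ := fun l => ((u l : ℤ) : ℝ) with hxdef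
    have hx : ∀ i, x i = 1 ∨ x i = -1 := by
      intro i
      rcases Int.units_eq_one_or (u i) with h | h <;> simp [hxdef, h]
    have h1 (i : ι) := sq_mulVec_of_boolean hs hd hv hx i
    have h2 : ∑ i, 2 * (a *ᵥ x) i ^ 2 = (x ⬝ᵥ a *ᵥ x) ^ 2 := by
      rw [Finset.sum_congr rfl fun i _ => h1 i, ← Finset.sum_mul, sq]
      rfl
    rw [hv x hx, ← Finset.mul_sum] at h2
    have h3 : ∑ i, (a *ᵥ x) i ^ 2 = 2 := by linarith
    simpa [mulVec, dotProduct, sq] using h3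
  have h := Finset.sum_congr rfl fun u (_ : u ∈ (Finset.univ : Finset (ι → ℤˣ))) => hu u
  rw [Finset.sum_comm] at h
  simp_rw [sum_signs_linear_mul] at h
  rw [← Finset.mul_sum] at h
  simp only [Finset.sum_const, Finset.card_univ, nsmul_eq_mul] at h
  exact mul_left_cancel₀ (by positivity) h

theorem mul_self_apply_of_boolean (hs : a.IsSymm) (hd : ∀ i, a i i = 0)
    (hv : ∀ x : ι → ℝ, (∀ i, x i = 1 ∨ x i = -1) → (x ⬝ᵥ a *ᵥ x) ^ 2 = 4)
    {i k : ι} (hik : i ≠ k) : ∑ l, a i l * a k l = 0 := by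
  have hu (u : ι → ℤˣ) : (∑ l, a i l * ((u l : ℤ) : ℝ)) * (∑ l, a k l * ((u l : ℤ) : ℝ)) =
      2 * a i k * (∑ l, a i l * (((u i : ℤ) : ℝ) * ((u l : ℤ) : ℝ)) +
        ∑ l, a k l * (((u k : ℤ) : ℝ) * ((u l : ℤ) : ℝ))) -
      2 * a i k ^ 2 * (((u i : ℤ) : ℝ) * ((u k : ℤ) : ℝ)) -
      a i k / 2 * ∑ p, ∑ q, a p q * (((u p : ℤ) : ℝ) * ((u q : ℤ) : ℝ)) := by
    set x : ι → ℝ := fun l => ((u l : ℤ) : ℝ) with hxdef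
    have hx : ∀ i, x i = 1 ∨ x i = -1 := by
      intro i
      rcases Int.units_eq_one_or (u i) with h | h <;> simp [hxdef, h]
    have hx' : ∀ j, Function.update x k (-x k) j = 1 ∨ Function.update x k (-x k) j = -1 := by
      intro j
      by_cases hj : j = k
      · subst hj; rcases hx j with h | h <;> simp [h]
      · simpa [hj] using hx j
    have h1 := sq_mulVec_of_boolean hs hd hv hx i
    have h2 := sq_mulVec_of_boolean hs hd hv hx' i
    rw [quadratic_flip hs hd, mulVec_flip, Function.update_of_ne hik] at h2
    have e1 (j : ι) : ∑ l, a j l * (x j * x l) = x j * (a *ᵥ x) j := by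
      simp only [mulVec, dotProduct, Finset.mul_sum]
      exact Finset.sum_congr rfl fun l _ => by ring
    have e2 : ∑ p, ∑ q, a p q * (x p * x q) = x ⬝ᵥ a *ᵥ x := by
      simp only [e1]; rfl
    have e3 (j : ι) : ∑ l, a j l * x l = (a *ᵥ x) j := rfl
    change (∑ l, a i l * x l) * (∑ l, a k l * x l) =
      2 * a i k * (∑ l, a i l * (x i * x l) + ∑ l, a k l * (x k * x l)) -
      2 * a i k ^ 2 * (x i * x k) - a i k / 2 * ∑ p, ∑ q, a p q * (x p * x q)
    rw [e1, e1, e2, e3, e3]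
    generalize (a *ᵥ x) i = y at *
    generalize (a *ᵥ x) k = z at *
    generalize x ⬝ᵥ a *ᵥ x = φ at *
    rcases hx i with h | h <;> rcases hx k with h' | h' <;>
      simp only [h, h'] at h1 h2 ⊢ <;> linarith
  have h := Finset.sum_congr rfl fun u (_ : u ∈ (Finset.univ : Finset (ι → ℤˣ))) => hu u
  rw [sum_signs_linear_mul] at h
  have hq (j : ι) : ∑ u : ι → ℤˣ, ∑ l, a j l * (((u j : ℤ) : ℝ) * ((u l : ℤ) : ℝ)) = 0 := by
    rw [Finset.sum_comm]
    simp_rw [← Finset.mul_sum, sum_signs_mul]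
    simp [hd]
  have hq2 : ∑ u : ι → ℤˣ, ∑ p, ∑ q, a p q * (((u p : ℤ) : ℝ) * ((u q : ℤ) : ℝ)) = 0 := by
    rw [Finset.sum_comm]
    simp [hq]
  simp only [Finset.sum_sub_distrib, ← Finset.mul_sum, Finset.sum_add_distrib, hq, hq2,
    sum_signs_mul, hik, if_false] at h
  simpa using h

end BooleanQuadratic

theorem GramSet.one_add_mem {N : ℕ} {a : Matrix (Fin N) (Fin N) ℝ} (hs : a.IsSymm)
    (hd : ∀ i, a i i = 0) {r : Fin N → ℝ} (hr : a * a = diagonal r) {t : ℝ}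
    (ht : ∀ i, t ^ 2 * r i ≤ 1) : 1 + t • a ∈ GramSet N := by
  refine ⟨?_, fun i => by simp [hd]⟩
  have h1 : (1 + t • a) = (1 / 2 : ℝ) • ((1 + t • a)ᴴ * (1 + t • a) +
      diagonal fun i => 1 - t ^ 2 * r i) := by
    have h2 : (1 + t • a)ᴴ = 1 + t • a := by
      rw [conjTranspose_eq_transpose_of_trivial, transpose_add, transpose_smul, hs.eq,
        transpose_one]
    have h3 : (diagonal fun i => 1 - t ^ 2 * r i) = 1 - (t ^ 2) • (a * a) := by
      rw [hr]; ext i j; by_cases h : i = j <;> simp [h]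
    rw [h2, h3]
    simp only [add_mul, mul_add, one_mul, mul_one, smul_mul_assoc, mul_smul_comm]
    module
  rw [h1]
  refine ((posSemidef_conjTranspose_mul_self _).add (posSemidef_diagonal_iff.2 fun i => ?_)).smul
    (by norm_num)
  linarith [ht i]

/-- A quadratic form with zero diagonal which is `±2` on sign vectors and at most `2` on the Gram
set depends on a single off-diagonal entry. -/
theorem exists_single_of_boolean {N : ℕ} [Nonempty (Fin N)] {a : Matrix (Fin N) (Fin N) ℝ}
    (hs : a.IsSymm) (hd : ∀ i, a i i = 0)
    (hv : ∀ x : Fin N → ℝ, (∀ i, x i = 1 ∨ x i = -1) → (x ⬝ᵥ a *ᵥ x) ^ 2 = 4)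
    (hG : ∀ G ∈ GramSet N, ∑ i, ∑ j, a i j * G i j ≤ 2) :
    ∃ k l, k ≠ l ∧ ∀ G : Matrix (Fin N) (Fin N) ℝ, G.IsSymm →
      ∑ i, ∑ j, a i j * G i j = 2 * a k l * G k l := by
  set r : Fin N → ℝ := fun i => ∑ l, a i l * a i l with hrdef
  have hsum : ∑ i, r i = 2 := sum_sq_of_boolean hs hd hv
  have hr : a * a = diagonal r := by
    ext i k
    rw [mul_apply, diagonal_apply]
    simp_rw [fun j => hs.apply k j]
    split_ifs with h
    · subst h; rfl
    · exact mul_self_apply_of_boolean hs hd hv h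
  have hr0 (i) : 0 ≤ r i := Finset.sum_nonneg fun l _ => mul_self_nonneg _
  obtain ⟨k, hk⟩ := Finite.exists_max r
  have hkpos : 0 < r k := by
    by_contra hcon
    have : ∑ i, r i ≤ 0 := Finset.sum_nonpos fun i _ => (hk i).trans (not_lt.1 hcon)
    linarith
  have hk1 : 1 ≤ r k := by
    have hmem : 1 + (√(r k))⁻¹ • a ∈ GramSet N := by
      refine GramSet.one_add_mem hs hd hr fun i => ?_
      rw [inv_pow, Real.sq_sqrt hkpos.le, inv_mul_le_iff₀ hkpos]
      simpa using hk i
    have h := hG _ hmem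
    have e (i j) : a i j * (1 + (√(r k))⁻¹ • a) i j = (√(r k))⁻¹ * (a i j * a i j) := by
      by_cases hij : i = j
      · subst hij; simp [hd]
      · simp [hij]; ring
    simp_rw [e, ← Finset.mul_sum] at h
    change (√(r k))⁻¹ * ∑ i, r i ≤ 2 at h
    rw [hsum] at h
    have hsq : 0 < √(r k) := Real.sqrt_pos.2 hkpos
    rw [inv_mul_le_iff₀ hsq] at h
    have : 1 ≤ √(r k) := by linarith
    exact Real.one_le_sqrt.1 this
  obtain ⟨l, hl⟩ : ∃ l, a k l ≠ 0 := by
    by_contra! hcon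
    simp [hrdef, hcon] at hkpos
  have hkl : k ≠ l := by rintro rfl; exact hl (hd k)
  have hrl : r l = r k := by
    have h : (a * (a * a)) k l = (a * a * a) k l := by rw [mul_assoc]
    rw [hr, mul_diagonal, diagonal_mul] at h
    exact mul_left_cancel₀ hl (by linarith)
  have hrest (p) (hpk : p ≠ k) (hpl : p ≠ l) : r p = 0 := by
    have h : ∑ i ∈ ({k, l, p} : Finset (Fin N)), r i ≤ ∑ i, r i :=
      Finset.sum_le_univ_sum_of_nonneg hr0
    rw [Finset.sum_insert (by simp [hkl, hpk.symm]), Finset.sum_pair hpl.symm] at h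
    linarith [hr0 p]
  have hzero (p q) (hpk : p ≠ k) (hpl : p ≠ l) : a p q = 0 := by
    have h := (Finset.sum_eq_zero_iff_of_nonneg fun l _ => mul_self_nonneg (a p l)).1
      (hrest p hpk hpl) q (Finset.mem_univ q)
    exact mul_self_eq_zero.1 h
  refine ⟨k, l, hkl, fun G hGs => ?_⟩
  rw [Fintype.sum_eq_add k l hkl fun p hp => Finset.sum_eq_zero fun q _ => by
      rw [hzero p q hp.1 hp.2, zero_mul],
    Fintype.sum_eq_single l, Fintype.sum_eq_single k, hs.apply k l, hGs.apply k l]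
  · ring
  · intro q hq
    by_cases h : q = l
    · rw [h, hd, zero_mul]
    · rw [← hs.apply, hzero q l hq h, zero_mul]
  · intro q hq
    by_cases h : q = k
    · rw [h, hd, zero_mul]
    · rw [← hs.apply, hzero q k h hq, zero_mul]

namespace GramSet

variable {N : ℕ} {G : Matrix (Fin N) (Fin N) ℝ}

theorem isSymm (hG : G ∈ GramSet N) : G.IsSymm := by
  have := hG.1.isHermitian.eq
  rwa [conjTranspose_eq_transpose_of_trivial] at this

theorem quadratic_nonneg (hG : G ∈ GramSet N) (x : Fin N → ℝ) : 0 ≤ x ⬝ᵥ G *ᵥ x := by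
  simpa using hG.1.dotProduct_mulVec_nonneg x

theorem abs_apply_le_one (hG : G ∈ GramSet N) (i j : Fin N) : |G i j| ≤ 1 := by
  have hs := (isSymm hG).apply i j
  have h1 := quadratic_nonneg hG (Pi.single i 1 + Pi.single j 1)
  have h2 := quadratic_nonneg hG (Pi.single i 1 - Pi.single j 1)
  simp only [mulVec_add, mulVec_sub, dotProduct_add, dotProduct_sub, add_dotProduct,
    sub_dotProduct, single_dotProduct, mulVec_single_one, col_apply, one_mul, hG.2, hs] at h1 h2
  exact abs_le.2 ⟨by linarith, by linarith⟩

/-- Correlations equal to `±1` propagate multiplicatively. -/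
theorem apply_eq_mul (hG : G ∈ GramSet N) {i j : Fin N} (hij : G i j = 1 ∨ G i j = -1)
    (k : Fin N) : G j k = G i j * G i k := by
  have hs := (isSymm hG).apply i j
  have h0 : star (Pi.single j 1 - Pi.single i (G i j)) ⬝ᵥ
      G *ᵥ (Pi.single j 1 - Pi.single i (G i j)) = 0 := by
    simp only [star_trivial, mulVec_sub, dotProduct_sub, sub_dotProduct, single_dotProduct,
      col_apply, one_mul, hG.2, hs, mulVec_single, Pi.smul_apply,
      MulOpposite.smul_eq_mul_unop, MulOpposite.unop_op]
    rcases hij with h | h <;> rw [h] <;> norm_num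
  have h1 := congrFun ((hG.1.dotProduct_mulVec_zero_iff _).1 h0) k
  simp only [mulVec_sub, mulVec_single, Pi.sub_apply, col_apply, Pi.smul_apply,
      MulOpposite.smul_eq_mul_unop, MulOpposite.unop_op, Pi.zero_apply] at h1
  rw [(isSymm hG).apply j k, (isSymm hG).apply i k] at h1
  linarith

theorem vecMulVec_mem {x : Fin N → ℝ} (hx : ∀ i, x i = 1 ∨ x i = -1) :
    vecMulVec x x ∈ GramSet N := by
  refine ⟨by simpa using posSemidef_vecMulVec_self_star x, fun i => ?_⟩
  rcases hx i with h | h <;> simp [vecMulVec_apply, h]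

theorem one_mem : (1 : Matrix (Fin N) (Fin N) ℝ) ∈ GramSet N :=
  ⟨PosSemidef.one, fun i => by simp⟩

theorem convex : Convex ℝ (GramSet N) := by
  intro G hG H hH a b ha hb hab
  refine ⟨(hG.1.smul ha).add (hH.1.smul hb), fun i => ?_⟩
  simp [hG.2, hH.2, hab]

theorem one_add_single_mem {k l : Fin N} (hkl : k ≠ l) {t : ℝ} (ht : |t| ≤ 1) :
    1 + t • (single k l 1 + single l k 1) ∈ GramSet N := by
  refine one_add_mem (r := fun i => if i = k ∨ i = l then 1 else 0) ?_ ?_ ?_ ?_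
  · simp [IsSymm, add_comm]
  · intro i
    simp only [Matrix.add_apply, single_apply]
    grind
  · rw [add_mul, mul_add, mul_add, single_mul_single_of_ne _ _ _ _ hkl.symm,
      single_mul_single_of_ne _ _ _ _ hkl, single_mul_single_same, single_mul_single_same]
    ext i j
    simp only [Matrix.add_apply, single_apply, diagonal_apply, Matrix.zero_apply]
    grind
  · intro i
    have : t ^ 2 ≤ 1 := (sq_le_one_iff_abs_le_one t).2 ht
    split_ifs <;> simp [this]

/-- A real function which is affine on the Gram set is given by an affine function of the
off-diagonal entries. -/
theorem exists_matrix_of_affine {f : Matrix (Fin N) (Fin N) ℝ → ℝ}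
    (hf : ∀ G ∈ GramSet N, ∀ G' ∈ GramSet N, ∀ α : ℝ, 0 ≤ α → α ≤ 1 →
      f (α • G + (1 - α) • G') = α * f G + (1 - α) * f G') :
    ∃ a : Matrix (Fin N) (Fin N) ℝ, a.IsSymm ∧ (∀ i, a i i = 0) ∧
      ∀ G ∈ GramSet N, f G = f 1 + 1 / 2 * ∑ i, ∑ j, a i j * G i j := by
  have hf' {G} (hG : G ∈ GramSet N) {H} (hH : H ∈ GramSet N) {a b : ℝ} (ha : 0 ≤ a)
      (hb : 0 ≤ b) (hab : a + b = 1) : f (a • G + b • H) = a • f G + b • f H := by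
    obtain rfl : b = 1 - a := by linarith
    exact hf G hG H hH a ha (by linarith)
  have hvex : ConvexOn ℝ (GramSet N) f :=
    ⟨convex, fun G hG H hH a b ha hb hab => (hf' hG hH ha hb hab).le⟩
  have hcave : ConcaveOn ℝ (GramSet N) f :=
    ⟨convex, fun G hG H hH a b ha hb hab => (hf' hG hH ha hb hab).ge⟩
  let E : Fin N → Fin N → Matrix (Fin N) (Fin N) ℝ := fun k l =>
    if k = l then 0 else single k l 1 + single l k 1
  have hE (k l) {t : ℝ} (ht : |t| ≤ 1) : 1 + t • E k l ∈ GramSet N := by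
    by_cases h : k = l
    · simpa [E, h] using one_mem
    · simpa only [E, h, if_false] using one_add_single_mem h ht
  have hEp (k l) : 1 + E k l ∈ GramSet N := by simpa using hE k l (t := 1) (by simp)
  have hEm (k l) : 1 - E k l ∈ GramSet N := by
    simpa [sub_eq_add_neg] using hE k l (t := -1) (by simp)
  have hsegment (k l) {t : ℝ} (ht : |t| ≤ 1) :
      f (1 + t • E k l) = f 1 + t * ((f (1 + E k l) - f (1 - E k l)) / 2) := by
    obtain ⟨h1, h2⟩ := abs_le.1 ht
    have e1 := hf _ (hEp k l) _ (hEm k l) ((1 + t) / 2) (by linarith) (by linarith)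
    have e2 := hf _ (hEp k l) _ (hEm k l) (1 / 2) (by norm_num) (by norm_num)
    have m1 : ((1 + t) / 2) • (1 + E k l) + (1 - (1 + t) / 2) • (1 - E k l) = 1 + t • E k l := by
      module
    have m2 : (1 / 2 : ℝ) • (1 + E k l) + (1 - 1 / 2 : ℝ) • (1 - E k l) = 1 := by
      module
    rw [m1] at e1
    rw [m2] at e2
    linarith
  refine ⟨of fun k l => (f (1 + E k l) - f (1 - E k l)) / 2, ?_, ?_, fun G hG => ?_⟩
  · ext k l
    have : E k l = E l k := by
      by_cases h : k = l
      · rw [h]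
      · simp [E, h, Ne.symm h, add_comm]
    simp [this]
  · intro i
    simp [E]
  set M : ℝ := (N : ℝ) * N / 2 with hM
  have hMpos : 0 < 1 + M := by positivity
  let w : Option (Fin N × Fin N) → ℝ := fun o => o.elim (1 / (1 + M)) fun _ => 1 / 2 / (1 + M)
  let p : Option (Fin N × Fin N) → Matrix (Fin N) (Fin N) ℝ := fun o =>
    o.elim G fun q => 1 + (-G q.1 q.2) • E q.1 q.2
  have habs (k l) : |-G k l| ≤ 1 := by rw [abs_neg]; exact abs_apply_le_one hG k l
  have hw0 : ∀ o ∈ Finset.univ, 0 ≤ w o := by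
    rintro (_ | q) - <;> simp only [w, Option.elim] <;> positivity
  have hw1 : ∑ o, w o = 1 := by
    simp only [w, Fintype.sum_option, Option.elim, Finset.sum_const, Finset.card_univ,
      Fintype.card_prod, Fintype.card_fin, nsmul_eq_mul, Nat.cast_mul]
    field_simp
    rw [hM]
    ring
  have hp : ∀ o ∈ Finset.univ, p o ∈ GramSet N := by
    rintro (_ | q) -
    · exact hG
    · exact hE _ _ (habs _ _)
  have hsumE : ∑ q : Fin N × Fin N, G q.1 q.2 • E q.1 q.2 = (2 : ℝ) • (G - 1) := by
    rw [Fintype.sum_prod_type]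
    have hEapply (k l i j) : (G k l • E k l) i j =
        (if k = i then if l = j then (if i = j then 0 else G i j) else 0 else 0) +
        (if l = i then if k = j then (if i = j then 0 else G j i) else 0 else 0) := by
      by_cases h : k = l
      · simp only [E, h, if_true]
        simp
        grind
      · simp only [E, h, if_false, Matrix.smul_apply, Matrix.add_apply, single_apply, smul_eq_mul]
        grind
    ext i j
    simp only [Matrix.sum_apply, hEapply, Finset.sum_add_distrib]
    have hdiag := hG.2 i
    have hs := (isSymm hG).apply i j
    by_cases h : i = j
    · subst h; simp [hdiag]
    · simp [h, hs]; ring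
  have hsump : ∑ o, w o • p o = 1 := by
    simp only [w, p, Fintype.sum_option, Option.elim, ← Finset.smul_sum, Finset.sum_add_distrib,
      neg_smul, Finset.sum_neg_distrib, hsumE, Finset.sum_const, Finset.card_univ,
      Fintype.card_prod, Fintype.card_fin, ← Nat.cast_smul_eq_nsmul ℝ, Nat.cast_mul]
    have : (N : ℝ) * N = 2 * M := by rw [hM]; ring
    rw [this]
    match_scalars <;> field_simp <;> ring
  have hJensen : f 1 = ∑ o, w o • f (p o) := by
    rw [← hsump]
    exact le_antisymm (hvex.map_sum_le hw0 hw1 hp) (hcave.le_map_sum hw0 hw1 hp)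
  have hsome : ∑ q : Fin N × Fin N, w (some q) • f (p (some q)) = 1 / 2 / (1 + M) *
      (2 * M * f 1 - ∑ i, ∑ j, (f (1 + E i j) - f (1 - E i j)) / 2 * G i j) := by
    simp only [w, p, Option.elim, hsegment _ _ (habs _ _), smul_eq_mul]
    rw [← Finset.mul_sum, Finset.sum_add_distrib, Fintype.sum_prod_type, Fintype.sum_prod_type]
    simp only [neg_mul, Finset.sum_neg_distrib, Finset.sum_const, Finset.card_univ,
      Fintype.card_fin, nsmul_eq_mul, mul_comm (G _ _)]
    rw [hM]
    ring
  rw [Fintype.sum_option, hsome] at hJensen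
  simp only [w, p, Option.elim, smul_eq_mul] at hJensen
  simp only [of_apply]
  field_simp at hJensen ⊢
  linarith

/-- The elements of the Gram set with all entries `±1`. -/
def vertices (N : ℕ) : Set (Matrix (Fin N) (Fin N) ℝ) :=
  {G | G ∈ GramSet N ∧ ∀ i j, G i j = 1 ∨ G i j = -1}

theorem finite_vertices : (vertices N).Finite := by
  refine Set.Finite.subset (Set.Finite.pi' (t := fun _ : Fin N =>
    {r : Fin N → ℝ | ∀ j, r j ∈ ({1, -1} : Set ℝ)}) fun i => Set.Finite.pi' fun j => ?_) ?_
  · exact Set.toFinite _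
  · intro G hG i j
    simpa using hG.2 i j

theorem vecMulVec_mem_vertices {x : Fin N → ℝ} (hx : ∀ i, x i = 1 ∨ x i = -1) :
    vecMulVec x x ∈ vertices N := by
  refine ⟨vecMulVec_mem hx, fun i j => ?_⟩
  rcases hx i with h | h <;> rcases hx j with h' | h' <;> simp [vecMulVec_apply, h, h']

theorem sum_vertices :
    ∑ G ∈ (finite_vertices (N := N)).toFinset, G =
      ((finite_vertices (N := N)).toFinset.card : ℝ) • 1 := by
  ext i j
  rw [Matrix.sum_apply]
  by_cases h : i = j
  · subst h
    rw [Finset.sum_congr rfl (g := fun _ => (1 : ℝ))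
      fun G hG => ((Set.Finite.mem_toFinset _).1 hG).1.2 i]
    simp
  · let s : Fin N → ℝ := Function.update 1 i (-1)
    have hs (k) : s k * s k = 1 := by
      by_cases hk : k = i <;> simp [s, hk]
    have hs' (k) : s k = 1 ∨ s k = -1 := by
      by_cases hk : k = i <;> simp [s, hk]
    have happ (G : Matrix (Fin N) (Fin N) ℝ) (k l) :
        (diagonal s * G * diagonal s) k l = s k * G k l * s l := by
      rw [mul_diagonal, diagonal_mul]
    have hflip (G : Matrix (Fin N) (Fin N) ℝ) : (diagonal s * G * diagonal s) i j = -G i j := by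
      rw [happ]
      simp [s, Ne.symm h]
    rw [Matrix.smul_apply, one_apply_ne h, smul_zero]
    refine Finset.sum_involution (fun G _ => diagonal s * G * diagonal s) ?_ ?_ ?_ ?_
    · intro G _
      rw [hflip, add_neg_cancel]
    · intro G _ hne heq
      have := congrFun (congrFun heq i) j
      rw [hflip] at this
      exact hne (by linarith)
    · intro G hG
      rw [Set.Finite.mem_toFinset] at hG ⊢
      refine ⟨⟨?_, fun k => ?_⟩, fun k l => ?_⟩
      · have := hG.1.1.mul_mul_conjTranspose_same (diagonal s)
        rwa [diagonal_conjTranspose, star_trivial] at this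
      · rw [happ, hG.1.2, mul_one, hs]
      · rw [happ]
        rcases hs' k with h1 | h1 <;> rcases hs' l with h2 | h2 <;>
          rcases hG.2 k l with h3 | h3 <;> simp [h1, h2, h3]
    · intro G _
      ext k l
      simp only [happ]
      linear_combination (G k l * s l * s l) * hs k + G k l * hs l

/-- Vertices are characterised by the absence of nondegenerate ellipses through them. -/
theorem eq_zero_of_ellipse_through_vertex {C B A : Matrix (Fin N) (Fin N) ℝ}
    (hv : C + B ∈ vertices N)
    (h : ∀ c s : ℝ, c ^ 2 + s ^ 2 = 1 → C + c • B + s • A ∈ GramSet N) : A = 0 := by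
  ext i j
  have key (t : ℝ) : 0 ≤ (C + B) i j * B i j * t ^ 2 - (C + B) i j * A i j * t := by
    have hpos : 0 < 1 + t ^ 2 := by positivity
    have h1 := abs_apply_le_one (h ((1 - t ^ 2) / (1 + t ^ 2)) (2 * t / (1 + t ^ 2))
      (by field_simp; ring)) i j
    obtain ⟨h2, h3⟩ := abs_le.1 h1
    simp only [Matrix.add_apply, Matrix.smul_apply, smul_eq_mul] at h2 h3
    have e : C i j + (1 - t ^ 2) / (1 + t ^ 2) * B i j + 2 * t / (1 + t ^ 2) * A i j =
        C i j + B i j - 2 * (B i j * t ^ 2 - A i j * t) / (1 + t ^ 2) := by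
      field_simp; ring
    rw [e] at h2 h3
    have hfrac (z : ℝ) (hz : 0 ≤ 2 * z / (1 + t ^ 2)) : 0 ≤ z := by
      by_contra! hneg
      have := div_neg_of_neg_of_pos (by linarith : 2 * z < 0) hpos
      linarith
    rcases hv.2 i j with h4 | h4
    · rw [h4]
      rw [Matrix.add_apply] at h4
      have := hfrac (B i j * t ^ 2 - A i j * t) (by linarith)
      linarith
    · rw [h4]
      rw [Matrix.add_apply] at h4
      have := hfrac (-(B i j * t ^ 2 - A i j * t)) (by rw [mul_neg, neg_div]; linarith)
      linarith
  have hzero : (C + B) i j * A i j = 0 := by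
    generalize (C + B) i j * A i j = y at key
    generalize (C + B) i j * B i j = z at key
    have hz : 0 < 1 + |z| := by positivity
    have h1 := key (y / (1 + |z|))
    have h2 : z * (y / (1 + |z|)) ^ 2 - y * (y / (1 + |z|)) =
        -(y ^ 2 * (1 + |z| - z)) / (1 + |z|) ^ 2 := by
      field_simp; ring
    rw [h2] at h1
    by_contra hy
    have h3 : 0 < y ^ 2 * (1 + |z| - z) := by
      have := le_abs_self z
      have : 0 < 1 + |z| - z := by linarith
      positivity
    have := div_neg_of_neg_of_pos (neg_neg_of_pos h3) (by positivity : 0 < (1 + |z|) ^ 2)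
    linarith
  rcases hv.2 i j with h4 | h4 <;> rw [h4] at hzero <;> simpa using hzero

theorem exists_ellipse_of_notMem_vertices (hG : G ∈ GramSet N) (hv : G ∉ vertices N) :
    ∃ C B A : Matrix (Fin N) (Fin N) ℝ, A ≠ 0 ∧ G = C + B ∧
      ∀ c s : ℝ, c ^ 2 + s ^ 2 = 1 → C + c • B + s • A ∈ GramSet N := by
  obtain ⟨i, j, h1, h2⟩ : ∃ i j, G i j ≠ 1 ∧ G i j ≠ -1 := by
    by_contra! hcon
    refine hv ⟨hG, fun i j => ?_⟩
    by_contra! h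
    exact h.2 (hcon i j h.1)
  have hij : i ≠ j := by
    rintro rfl
    exact h1 (hG.2 i)
  have hlt : 0 < 1 - G i j ^ 2 := by
    have h3 := (sq_le_one_iff_abs_le_one _).2 (abs_apply_le_one hG i j)
    have h4 : G i j ^ 2 ≠ 1 := fun h => (by simpa using h : G i j = 1 ∨ G i j = -1).elim h1 h2
    have := lt_of_le_of_ne h3 h4
    linarith
  set g := G i j with hg
  set q := √(1 - g ^ 2) with hq
  have hqpos : 0 < q := Real.sqrt_pos.2 hlt
  have hqq : q ^ 2 = 1 - g ^ 2 := Real.sq_sqrt hlt.le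
  have hs (k l) : G k l = G l k := (isSymm hG).apply l k
  -- the inner products with the unit vector orthogonal to the `i`-th Gram vector
  let w : Fin N → ℝ := fun k => (G j k - g * G i k) / q
  let C : Matrix (Fin N) (Fin N) ℝ := of fun k l =>
    if k = i then (if l = i then 1 else 0) else if l = i then 0 else G k l
  let B : Matrix (Fin N) (Fin N) ℝ := of fun k l =>
    if k = i then (if l = i then 0 else G i l) else if l = i then G i k else 0
  let A : Matrix (Fin N) (Fin N) ℝ := of fun k l =>
    if k = i then (if l = i then 0 else w l) else if l = i then w k else 0
  refine ⟨C, B, A, ?_, ?_, fun c s hcs => ⟨?_, fun k => ?_⟩⟩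
  · intro hA
    have h := congrFun (congrFun hA i) j
    simp only [A, of_apply, if_true, hij.symm, if_false, w, hG.2, Matrix.zero_apply, ← hg] at h
    rw [div_eq_zero_iff] at h
    rcases h with h | h <;> nlinarith
  · ext k l
    have := hG.2 i
    have := hs k i
    simp only [C, B, of_apply, Matrix.add_apply]
    grind
  · let T : Matrix (Fin N) (Fin N) ℝ :=
      1 + single i i (c - s * g / q - 1) + single i j (s / q)
    have hT : C + c • B + s • A = T * G * Tᴴ := by
      have hTG (M : Matrix (Fin N) (Fin N) ℝ) (k l) : (T * M) k l =
          M k l + if k = i then (c - s * g / q - 1) * M i l + s / q * M j l else 0 := by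
        by_cases hk : k = i
        · subst hk
          simp [T, add_mul]
          ring
        · simp [T, add_mul, hk]
      have hsymm : T * G * Tᴴ = (T * (T * G)ᵀ)ᵀ := by
        rw [transpose_mul, transpose_transpose, conjTranspose_eq_transpose_of_trivial]
      rw [hsymm]
      ext k l
      simp only [transpose_apply, hTG]
      have e1 := hG.2 i
      have e2 := hG.2 j
      have e3 := hs k i
      have e4 := hs k j
      have e5 := hs j i
      by_cases hk : k = i
      · subst hk
        by_cases hl : l = k
        · subst hl
          simp only [C, B, A, of_apply, Matrix.add_apply, Matrix.smul_apply, if_true,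
            smul_eq_mul, e1, e2, e5,
            ← hg]
          field_simp
          linear_combination s ^ 2 * hqq - q ^ 2 * hcs
        · simp only [C, B, A, of_apply, Matrix.add_apply, Matrix.smul_apply, if_true, hl,
            if_false, smul_eq_mul,
            w]
          field_simp
          ring
      · by_cases hl : l = i
        · subst hl
          simp only [C, B, A, of_apply, Matrix.add_apply, Matrix.smul_apply, if_true, hk,
            if_false, smul_eq_mul,
            w, e3, e4]
          field_simp
          ring
        · simp [C, B, A, hk, hl]
    rw [hT]
    exact hG.1.mul_mul_conjTranspose_same T
  · by_cases hk : k = i <;> simp [C, B, A, hk, hG.2]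

end GramSet

theorem Matrix.IsSymm.apply_eq_of_pair_eq {n R : Type*} [DecidableEq n] {A : Matrix n n R}
    (hA : A.IsSymm) {i j k l : n} (h : ({i, j} : Finset n) = {k, l}) : A i j = A k l := by
  rw [← Finset.coe_inj, Finset.coe_pair, Finset.coe_pair, Set.pair_eq_pair_iff] at h
  rcases h with ⟨rfl, rfl⟩ | ⟨rfl, rfl⟩
  · rfl
  · exact hA.apply _ _

namespace IsAffineBijOfGramSet

variable {N : ℕ} {σ : Matrix (Fin N) (Fin N) ℝ → Matrix (Fin N) (Fin N) ℝ}

theorem exists_matrix (hσ : IsAffineBijOfGramSet N σ) (p q : Fin N) :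
    ∃ a : Matrix (Fin N) (Fin N) ℝ, a.IsSymm ∧ (∀ i, a i i = 0) ∧
      ∀ G ∈ GramSet N, σ G p q = σ 1 p q + 1 / 2 * ∑ i, ∑ j, a i j * G i j := by
  refine GramSet.exists_matrix_of_affine (f := fun G => σ G p q) fun G hG G' hG' α h0 h1 => ?_
  simp [hσ.2 G hG G' hG' α h0 h1]

theorem exists_linearMap (hσ : IsAffineBijOfGramSet N σ) :
    ∃ L : Matrix (Fin N) (Fin N) ℝ →ₗ[ℝ] Matrix (Fin N) (Fin N) ℝ,
      ∀ G ∈ GramSet N, σ G = σ 1 + L G := by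
  choose a _ _ ha using hσ.exists_matrix
  refine ⟨{ toFun := fun G => of fun p q => 1 / 2 * ∑ i, ∑ j, a p q i j * G i j
            map_add' := fun G H => ?_
            map_smul' := fun c G => ?_ }, fun G hG => ?_⟩
  · ext p q
    simp [mul_add, Finset.sum_add_distrib]
  · ext p q
    simp only [of_apply, Matrix.smul_apply, smul_eq_mul, RingHom.id_apply, Finset.mul_sum]
    exact Finset.sum_congr rfl fun i _ => Finset.sum_congr rfl fun j _ => by ring
  · ext p q
    exact ha p q G hG

theorem mem_vertices_of_apply_mem (hσ : IsAffineBijOfGramSet N σ) {G : Matrix (Fin N) (Fin N) ℝ}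
    (hG : G ∈ GramSet N) (hv : σ G ∈ GramSet.vertices N) : G ∈ GramSet.vertices N := by
  by_contra hcon
  obtain ⟨C, B, A, hA, rfl, hell⟩ := GramSet.exists_ellipse_of_notMem_vertices hG hcon
  obtain ⟨L, hL⟩ := hσ.exists_linearMap
  have hLA : L A = 0 := by
    refine GramSet.eq_zero_of_ellipse_through_vertex (C := σ 1 + L C) (B := L B) ?_ ?_
    · rwa [add_assoc, ← map_add, ← hL _ hG]
    · intro c s hcs
      rw [← map_smul, ← map_smul, add_assoc, add_assoc, ← map_add, ← map_add, ← add_assoc,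
        ← hL _ (hell c s hcs)]
      exact hσ.1.mapsTo (hell c s hcs)
  have h1 := hell 0 1 (by norm_num)
  have h2 := hell 0 (-1) (by norm_num)
  have h3 : C + (0 : ℝ) • B + (1 : ℝ) • A = C + (0 : ℝ) • B + (-1 : ℝ) • A := by
    apply hσ.1.injOn h1 h2
    rw [hL _ h1, hL _ h2]
    simp [hLA]
  have h4 : (2 : ℝ) • A = 0 := by
    have := add_left_cancel h3
    rw [two_smul]
    nth_rewrite 1 [← one_smul ℝ A]
    rw [this]
    simp
  exact hA ((smul_eq_zero.1 h4).resolve_left two_ne_zero)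

theorem image_vertices (hσ : IsAffineBijOfGramSet N σ) :
    σ '' GramSet.vertices N = GramSet.vertices N := by
  have hsub : GramSet.vertices N ⊆ σ '' GramSet.vertices N := by
    intro H hH
    obtain ⟨G, hG, rfl⟩ := hσ.1.surjOn hH.1
    exact ⟨G, hσ.mem_vertices_of_apply_mem hG hH, rfl⟩
  exact (Set.eq_of_subset_of_ncard_le hsub (Set.ncard_image_le GramSet.finite_vertices)
    (GramSet.finite_vertices.image σ)).symm

theorem apply_mem_vertices (hσ : IsAffineBijOfGramSet N σ) {G : Matrix (Fin N) (Fin N) ℝ}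
    (hG : G ∈ GramSet.vertices N) : σ G ∈ GramSet.vertices N :=
  hσ.image_vertices ▸ Set.mem_image_of_mem σ hG

theorem map_one (hσ : IsAffineBijOfGramSet N σ) : σ 1 = 1 := by
  classical
  obtain ⟨L, hL⟩ := hσ.exists_linearMap
  have hL1 : L 1 = 0 := by simpa using hL 1 GramSet.one_mem
  set V := (GramSet.finite_vertices (N := N)).toFinset with hV
  have hmem (G) : G ∈ V ↔ G ∈ GramSet.vertices N := Set.Finite.mem_toFinset _
  have himage : V.image σ = V := by
    ext G
    rw [hmem, ← hσ.image_vertices]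
    simp [hmem]
  have hinj : Set.InjOn σ V := fun G hG H hH h =>
    hσ.1.injOn ((hmem G).1 hG).1 ((hmem H).1 hH).1 h
  have hsum : ∑ G ∈ V, σ G = ∑ G ∈ V, G := by
    conv_rhs => rw [← himage, Finset.sum_image hinj]
  have hcard : (V.card : ℝ) ≠ 0 := by
    have hJ : vecMulVec 1 1 ∈ V :=
      (hmem _).2 (GramSet.vecMulVec_mem_vertices fun _ => Or.inl rfl)
    exact_mod_cast (Finset.card_pos.2 ⟨_, hJ⟩).ne'
  rw [Finset.sum_congr rfl fun G hG => hL G ((hmem G).1 hG).1, Finset.sum_add_distrib,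
    ← map_sum, GramSet.sum_vertices, _root_.map_smul, hL1, smul_zero, add_zero, Finset.sum_const,
    ← Nat.cast_smul_eq_nsmul ℝ] at hsum
  exact smul_right_injective _ hcard hsum

theorem exists_apply_eq (hσ : IsAffineBijOfGramSet N σ) {p q : Fin N} (hpq : p ≠ q) :
    ∃ k l, k ≠ l ∧ ∀ G ∈ GramSet N, σ G p q = σ (vecMulVec 1 1) p q * G k l := by
  have : Nonempty (Fin N) := ⟨p⟩
  obtain ⟨a, hs, hd, ha⟩ := hσ.exists_matrix p q
  simp only [hσ.map_one, one_apply_ne hpq, zero_add] at ha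
  have key := exists_single_of_boolean hs hd ?_ ?_
  · obtain ⟨k, l, hkl, h⟩ := key
    have ha' : ∀ G ∈ GramSet N, σ G p q = a k l * G k l := by
      intro G hG
      rw [ha G hG, h G (GramSet.isSymm hG)]
      ring
    refine ⟨k, l, hkl, fun G hG => ?_⟩
    rw [ha' G hG, ha' (vecMulVec 1 1) (GramSet.vecMulVec_mem fun _ => Or.inl rfl)]
    simp [vecMulVec_apply]
  · intro x hx
    have h1 := GramSet.vecMulVec_mem_vertices hx
    have h2 := (hσ.apply_mem_vertices h1).2 p q
    rw [ha _ h1.1] at h2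
    have h3 : ∑ i, ∑ j, a i j * vecMulVec x x i j = x ⬝ᵥ a *ᵥ x := by
      simp only [dotProduct, mulVec, Finset.mul_sum, vecMulVec_apply]
      exact Finset.sum_congr rfl fun i _ => Finset.sum_congr rfl fun j _ => by ring
    rw [h3] at h2
    rcases h2 with h2 | h2
    · rw [show x ⬝ᵥ a *ᵥ x = 2 by linarith]; norm_num
    · rw [show x ⬝ᵥ a *ᵥ x = -2 by linarith]; norm_num
  · intro G hG
    have h1 := (abs_le.1 (GramSet.abs_apply_le_one (hσ.1.mapsTo hG) p q)).2
    rw [ha G hG] at h1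
    linarith

end IsAffineBijOfGramSet

/-- Every affine bijection of the Gram set is induced by a permutation combined with
partial reflections: `σ(G) = (D P) G (D P)ᵀ` for a permutation matrix `P` and a sign
diagonal matrix `D`. -/
theorem affineBij_eq_signedPerm (N : ℕ)
    (σ : Matrix (Fin N) (Fin N) ℝ → Matrix (Fin N) (Fin N) ℝ)
    (hσ : IsAffineBijOfGramSet N σ) :
    ∃ (e : Equiv.Perm (Fin N)) (d : Fin N → ℝ), (∀ i, d i = 1 ∨ d i = -1) ∧
      ∀ G ∈ GramSet N,
        σ G = (Matrix.diagonal d * e.permMatrix ℝ) * G *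
          (Matrix.diagonal d * e.permMatrix ℝ)ᵀ := by
  rcases isEmpty_or_nonempty (Fin N) with hN | ⟨⟨o⟩⟩
  · exact ⟨1, 1, fun i => hN.elim i, fun G _ => Subsingleton.elim _ _⟩
  -- the images of the all-ones matrix and of its one-sign switchings
  set J := σ (vecMulVec 1 1) with hJ
  let flip : Fin N → Fin N → ℝ := fun m => Function.update 1 m (-1)
  have hflip (m i) : flip m i = 1 ∨ flip m i = -1 := by
    by_cases h : i = m <;> simp [flip, h]
  let W : Fin N → Matrix (Fin N) (Fin N) ℝ := fun m => σ (vecMulVec (flip m) (flip m))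
  have hJv : J ∈ GramSet.vertices N :=
    hσ.apply_mem_vertices (GramSet.vecMulVec_mem_vertices fun _ => Or.inl rfl)
  have hWv (m) : W m ∈ GramSet.vertices N :=
    hσ.apply_mem_vertices (GramSet.vecMulVec_mem_vertices (hflip m))
  choose! k l hkl hσkl using fun p q => hσ.exists_apply_eq (p := p) (q := q)
  simp only [← hJ] at hσkl
  let P : Fin N → Fin N → Finset (Fin N) := fun p q => {m | W m p q ≠ J p q}
  have hP {p q} (hpq : p ≠ q) : P p q = {k p q, l p q} := by
    ext m
    simp only [P, W, Finset.mem_filter, Finset.mem_univ, true_and, Finset.mem_insert,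
      Finset.mem_singleton, hσkl p q hpq _ (GramSet.vecMulVec_mem (hflip m)),
      vecMulVec_apply]
    have h1 : J p q ≠ 0 := by rcases hJv.2 p q with h | h <;> simp [h]
    have h2 := hkl p q hpq
    by_cases hk : k p q = m
    · subst hk
      have : flip (k p q) (l p q) = 1 := by simp [flip, h2.symm]
      rw [this]
      simp only [flip, Function.update_self, mul_one, mul_neg, true_or, iff_true]
      intro h
      exact h1 (by linarith)
    · by_cases hl : l p q = m
      · subst hl
        have : flip (l p q) (k p q) = 1 := by simp [flip, h2]
        rw [this]
        simp only [flip, Function.update_self, mul_one, mul_neg, or_true, iff_true]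
        intro h
        exact h1 (by linarith)
      · simp [flip, hk, hl, Ne.symm hk, Ne.symm hl]
  obtain ⟨e, he⟩ := exists_perm_of_symmDiff P
    (fun p q hpq => by rw [hP hpq, Finset.card_pair (hkl p q hpq)])
    (fun i j q m => by
      simp only [P, Finset.mem_filter, Finset.mem_univ, true_and]
      rw [GramSet.apply_eq_mul hJv.1 (hJv.2 i j) q,
        GramSet.apply_eq_mul (hWv m).1 ((hWv m).2 i j) q]
      rcases hJv.2 i j with h1 | h1 <;> rcases hJv.2 i q with h2 | h2 <;>
        rcases (hWv m).2 i j with h3 | h3 <;> rcases (hWv m).2 i q with h4 | h4 <;>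
        rw [h1, h2, h3, h4] <;> norm_num)
    (fun i j p q hij hpq hip hiq h => by
      rw [hP hij, hP hpq] at h
      obtain ⟨G, hG, hGeq⟩ := hσ.1.surjOn
        (GramSet.one_add_single_mem hij (t := 1) (by norm_num))
      have h1 : σ G i j = 1 := by simp [hGeq, hij, hij.symm]
      have h2 : σ G p q = 0 := by
        simp [hGeq, hpq, hip, hiq]
      rw [hσkl i j hij G hG, (GramSet.isSymm hG).apply_eq_of_pair_eq h] at h1
      rw [hσkl p q hpq G hG] at h2
      rcases hJv.2 p q with h3 | h3 <;> rw [h3] at h2 <;> simp at h2 <;> simp [h2] at h1)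
  refine ⟨e, J o, hJv.2 o, fun G hG => ?_⟩
  have hrhs (i j) : ((Matrix.diagonal (J o) * e.permMatrix ℝ) * G *
      (Matrix.diagonal (J o) * e.permMatrix ℝ)ᵀ) i j = J o i * J o j * G (e i) (e j) := by
    have hperm : e.permMatrix ℝ * G * (e.permMatrix ℝ)ᵀ = G.submatrix e e := by
      rw [Equiv.Perm.permMatrix, ← PEquiv.toMatrix_symm, PEquiv.toMatrix_toPEquiv_mul,
        ← Equiv.toPEquiv_symm, PEquiv.mul_toMatrix_toPEquiv]
      rfl
    rw [transpose_mul, diagonal_transpose, ← Matrix.mul_assoc, Matrix.mul_assoc (diagonal _),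
      Matrix.mul_assoc (diagonal _), hperm, mul_diagonal, diagonal_mul, submatrix_apply]
    ring
  ext i j
  rw [hrhs, ← GramSet.apply_eq_mul hJv.1 (hJv.2 o i) j]
  rcases eq_or_ne i j with rfl | hij
  · rw [(hσ.1.mapsTo hG).2, hJv.1.2, hG.2, mul_one]
  · rw [hσkl i j hij G hG, (GramSet.isSymm hG).apply_eq_of_pair_eq
      ((hP hij).symm.trans (he i j hij))]
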